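/- Let $u : [\varepsilon,T] \times \mathbb{R}^3 \to \mathbb{R}^3$ be a smooth solution of the diffusive Burgers equations, $2\pi$-periodic in every spatial coordinate. Then for all $t \in [\varepsilon,T]$, $\Big( \int_{[0,2\pi]^3} |\nabla u(t,x)|^2 dx \Big)^{1/2} \le \Big( \int_{[0,2\pi]^3} |\nabla u(\varepsilon,x)|^2 dx \Big)^{1/2} \exp\Big( \tfrac{1}{2}(t-\varepsilon) \big( \sup_x |u(\varepsilon,x)| \big)^2 \Big)$, where $|\nabla u|^2 = \sum_{i,j=1}^3 (\partial_j u_i)^2$. -/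

import Mathlib

open Real MeasureTheory

/-- The `j`-th spatial partial derivative of a scalar function on `ℝ³`. -/
noncomputable def pd (j : Fin 3) (f : (Fin 3 → ℝ) → ℝ) (x : Fin 3 → ℝ) : ℝ :=
  fderiv ℝ f x (Pi.single j 1)

/-- The Laplacian of a scalar function on `ℝ³`. -/
noncomputable def lap (f : (Fin 3 → ℝ) → ℝ) (x : Fin 3 → ℝ) : ℝ :=
  ∑ j : Fin 3, pd j (fun y => pd j f y) x

/-- The fundamental periodicity cell `[0,2π]³`. -/
def box : Set (Fin 3 → ℝ) := Set.Icc (0 : Fin 3 → ℝ) (fun _ => 2 * Real.pi)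

section DirDeriv

open Set Filter Topology

variable {E : Type*} [NormedAddCommGroup E] [NormedSpace ℝ E] {f g : E → ℝ} {p v : E}

/-- The derivative of a scalar function `f` in the direction `v`. -/
noncomputable def dirDeriv (v : E) (f : E → ℝ) (p : E) : ℝ :=
  fderiv ℝ f p v

protected lemma ContDiff.dirDeriv (hf : ContDiff ℝ (⊤ : ℕ∞) f) (v : E) :
    ContDiff ℝ (⊤ : ℕ∞) (dirDeriv v f) :=
  (hf.fderiv_right (m := ((⊤ : ℕ∞) : WithTop ℕ∞)) (by simp)).clm_apply contDiff_const

lemma ContDiff.differentiable_of_top (hf : ContDiff ℝ (⊤ : ℕ∞) f) : Differentiable ℝ f :=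
  hf.differentiable (by simp)

lemma dirDeriv_comm (hf : ContDiff ℝ (⊤ : ℕ∞) f) (v w p : E) :
    dirDeriv v (dirDeriv w f) p = dirDeriv w (dirDeriv v f) p := by
  have hd : Differentiable ℝ (fderiv ℝ f) :=
    (hf.fderiv_right (m := ((⊤ : ℕ∞) : WithTop ℕ∞)) (by simp)).differentiable (by simp)
  have key : ∀ v w : E, dirDeriv v (dirDeriv w f) p = fderiv ℝ (fderiv ℝ f) p v w := by
    intro v w
    have h := (hd p).hasFDerivAt.clm_apply (hasFDerivAt_const w p)
    change fderiv ℝ (fun q => fderiv ℝ f q w) p v = _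
    rw [h.fderiv]
    simp
  rw [key, key]
  exact second_derivative_symmetric (fun y => (hf.differentiable_of_top y).hasFDerivAt)
    (hd p).hasFDerivAt v w

lemma dirDeriv_sum {ι : Type*} (s : Finset ι) {F : ι → E → ℝ}
    (hF : ∀ i ∈ s, DifferentiableAt ℝ (F i) p) :
    dirDeriv v (fun q => ∑ i ∈ s, F i q) p = ∑ i ∈ s, dirDeriv v (F i) p := by
  unfold dirDeriv
  rw [fderiv_fun_sum hF]
  simp

lemma dirDeriv_mul (hf : DifferentiableAt ℝ f p) (hg : DifferentiableAt ℝ g p) :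
    dirDeriv v (fun q => f q * g q) p = dirDeriv v f p * g p + f p * dirDeriv v g p := by
  unfold dirDeriv
  rw [fderiv_fun_mul hf hg]
  simp
  ring

lemma dirDeriv_sq (hf : DifferentiableAt ℝ f p) :
    dirDeriv v (fun q => f q ^ 2) p = 2 * f p * dirDeriv v f p := by
  simp only [pow_two]
  rw [dirDeriv_mul hf hf]
  ring

lemma dirDeriv_sub (hf : DifferentiableAt ℝ f p) (hg : DifferentiableAt ℝ g p) :
    dirDeriv v (fun q => f q - g q) p = dirDeriv v f p - dirDeriv v g p := by
  unfold dirDeriv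
  rw [fderiv_fun_sub hf hg]
  simp

protected lemma Function.Periodic.dirDeriv {c : E} (hf : Function.Periodic f c) (v : E) :
    Function.Periodic (dirDeriv v f) c := by
  intro p
  have h : (fun q => f (q + c)) = f := funext hf
  change fderiv ℝ f (p + c) v = fderiv ℝ f p v
  rw [← fderiv_comp_add_right, h]

lemma hasDerivAt_comp_line (hf : Differentiable ℝ f) (p v : E) (s : ℝ) :
    HasDerivAt (fun r : ℝ => f (p + r • v)) (dirDeriv v f (p + s • v)) s := by
  have h : HasDerivAt (fun r : ℝ => p + r • v) v s := by
    simpa using ((hasDerivAt_id s).smul_const v).const_add p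
  exact (hf _).hasFDerivAt.comp_hasDerivAt s h

lemma dirDeriv_eq_zero_of_line_max (hf : Differentiable ℝ f)
    (hmax : ∀ s : ℝ, f (p + s • v) ≤ f p) : dirDeriv v f p = 0 := by
  have h : IsLocalMax (fun r : ℝ => f (p + r • v)) 0 :=
    Eventually.of_forall fun s => by simpa using hmax s
  simpa using h.hasDerivAt_eq_zero (hasDerivAt_comp_line hf p v 0)

lemma dirDeriv_dirDeriv_nonpos_of_line_max (hf : ContDiff ℝ (⊤ : ℕ∞) f)
    (hmax : ∀ s : ℝ, f (p + s • v) ≤ f p) : dirDeriv v (dirDeriv v f) p ≤ 0 := by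
  by_contra! hpos
  set g : ℝ → ℝ := fun r => f (p + r • v) with hg
  have hd : ∀ s, HasDerivAt g (dirDeriv v f (p + s • v)) s :=
    hasDerivAt_comp_line hf.differentiable_of_top p v
  have hderiv : deriv g = fun s => dirDeriv v f (p + s • v) := funext fun s => (hd s).deriv
  have hdd : deriv (deriv g) 0 = dirDeriv v (dirDeriv v f) p := by
    rw [hderiv]
    simpa using (hasDerivAt_comp_line (hf.dirDeriv v).differentiable_of_top p v 0).deriv
  have h0 : deriv g 0 = 0 := by
    rw [hderiv]
    simpa using dirDeriv_eq_zero_of_line_max hf.differentiable_of_top hmax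
  have hmin : IsLocalMin g 0 :=
    isLocalMin_of_deriv_deriv_pos (by rw [hdd]; exact hpos) h0 (hd 0).continuousAt
  have hconst : g =ᶠ[𝓝 0] fun _ => g 0 := by
    filter_upwards [hmin] with s hs
    exact le_antisymm (by simpa [hg] using hmax s) hs
  have hzero : deriv (deriv g) 0 = 0 := by
    rw [hconst.deriv.deriv_eq]
    simp
  linarith

end DirDeriv

section Periodic

open Set Filter Topology

/-- The unit vector of `ℝ × ℝ³` in the time direction. -/
def timeDir : ℝ × (Fin 3 → ℝ) := (1, 0)

/-- The unit vector of `ℝ × ℝ³` in the `j`-th spatial direction. -/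
def spaceDir (j : Fin 3) : ℝ × (Fin 3 → ℝ) := (0, Pi.single j 1)

/-- `2π`-periodicity in each spatial coordinate of a function on `ℝ × ℝ³`. -/
def SpacePeriodic (f : ℝ × (Fin 3 → ℝ) → ℝ) : Prop :=
  ∀ j : Fin 3, Function.Periodic f (0, Pi.single j (2 * Real.pi))

variable {f : ℝ × (Fin 3 → ℝ) → ℝ}

protected lemma SpacePeriodic.dirDeriv (hf : SpacePeriodic f) (v : ℝ × (Fin 3 → ℝ)) :
    SpacePeriodic (dirDeriv v f) :=
  fun j => (hf j).dirDeriv v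

lemma isCompact_box : IsCompact box := isCompact_Icc

lemma Continuous.integrableOn_box (hf : Continuous f) (t : ℝ) :
    IntegrableOn (fun x => f (t, x)) box :=
  (hf.comp (by fun_prop : Continuous fun x : Fin 3 → ℝ => (t, x))).continuousOn.integrableOn_compact
    isCompact_box

lemma SpacePeriodic.exists_mem_box (hf : SpacePeriodic f) (t : ℝ) (x : Fin 3 → ℝ) :
    ∃ y ∈ box, f (t, y) = f (t, x) := by
  let n : Fin 3 → ℤ := fun j => toIcoDiv Real.two_pi_pos 0 (x j)
  refine ⟨fun j => toIcoMod Real.two_pi_pos 0 (x j), ⟨fun j => ?_, fun j => ?_⟩, ?_⟩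
  · exact (toIcoMod_mem_Ico Real.two_pi_pos 0 (x j)).1
  · simpa using (toIcoMod_mem_Ico Real.two_pi_pos 0 (x j)).2.le
  · have hx : (t, x) = (t, fun j => toIcoMod Real.two_pi_pos 0 (x j))
        + n 0 • ((0 : ℝ), (Pi.single 0 (2 * Real.pi) : Fin 3 → ℝ))
        + n 1 • ((0 : ℝ), (Pi.single 1 (2 * Real.pi) : Fin 3 → ℝ))
        + n 2 • ((0 : ℝ), (Pi.single 2 (2 * Real.pi) : Fin 3 → ℝ)) := by
      ext j
      · simp
      · have h := toIcoMod_add_toIcoDiv_zsmul Real.two_pi_pos 0 (x j)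
        fin_cases j <;> simp_all [n]
    rw [hx, ((hf 2).zsmul (n 2)) _, ((hf 1).zsmul (n 1)) _, ((hf 0).zsmul (n 0)) _]

lemma pd_slice (hf : Differentiable ℝ f) (t : ℝ) (x : Fin 3 → ℝ) (j : Fin 3) :
    pd j (fun y => f (t, y)) x = dirDeriv (spaceDir j) f (t, x) := by
  have h : HasFDerivAt (fun y : Fin 3 → ℝ => (t, y)) (ContinuousLinearMap.inr ℝ ℝ (Fin 3 → ℝ)) x :=
    hasFDerivAt_prodMk_right t x
  have hc := (hf (t, x)).hasFDerivAt.comp x h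
  change fderiv ℝ (f ∘ fun y => (t, y)) x _ = fderiv ℝ f (t, x) _
  rw [hc.fderiv]
  simp [spaceDir]

lemma hasDerivAt_time_slice (hf : Differentiable ℝ f) (t : ℝ) (x : Fin 3 → ℝ) :
    HasDerivAt (fun s => f (s, x)) (dirDeriv timeDir f (t, x)) t := by
  simpa [timeDir] using hasDerivAt_comp_line hf (0, x) timeDir t

/-- The divergence theorem on the periodicity cell: there are no boundary terms. -/
lemma integral_box_divergence_eq_zero {F : Fin 3 → ℝ × (Fin 3 → ℝ) → ℝ}
    (hF : ∀ j, ContDiff ℝ (⊤ : ℕ∞) (F j)) (hper : ∀ j, SpacePeriodic (F j)) (t : ℝ) :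
    ∫ x in box, ∑ j, dirDeriv (spaceDir j) (F j) (t, x) = 0 := by
  have hd : ∀ j, Differentiable ℝ (fun y => F j (t, y)) := fun j =>
    (hF j).differentiable_of_top.comp (by fun_prop)
  have hcont : Continuous fun x : Fin 3 → ℝ => ∑ j, dirDeriv (spaceDir j) (F j) (t, x) :=
    continuous_finsetSum _ fun j _ => ((hF j).dirDeriv _).continuous.comp (by fun_prop)
  have hdiv : ∀ x : Fin 3 → ℝ, ∑ j, fderiv ℝ (fun y => F j (t, y)) x (Pi.single j 1)
      = ∑ j, dirDeriv (spaceDir j) (F j) (t, x) := fun x =>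
    Finset.sum_congr rfl fun j _ => pd_slice (hF j).differentiable_of_top t x j
  have h := integral_divergence_of_hasFDerivAt_off_countable'
    (0 : Fin 3 → ℝ) (fun _ => 2 * Real.pi) (fun _ => Real.two_pi_pos.le)
    (fun j y => F j (t, y)) (fun j x => fderiv ℝ (fun y => F j (t, y)) x) ∅ countable_empty
    (fun j => (hd j).continuous.continuousOn) (fun x _ j => (hd j x).hasFDerivAt)
    (by simp only [hdiv]; exact hcont.continuousOn.integrableOn_compact isCompact_Icc)
  simp only [hdiv] at h
  rw [box, h]
  refine Finset.sum_eq_zero fun j _ => sub_eq_zero.2 ?_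
  congr 1
  funext y
  have hins : (t, (j.insertNth (2 * Real.pi) y : Fin 3 → ℝ))
      = (t, (j.insertNth 0 y : Fin 3 → ℝ)) + (0, Pi.single j (2 * Real.pi)) := by
    ext k
    · simp
    · refine Fin.succAboveCases j ?_ (fun l => ?_) k <;> simp
  change F j (t, j.insertNth (2 * Real.pi) y) = F j (t, j.insertNth 0 y)
  rw [hins, hper j j]

lemma hasDerivAt_integral_box (hf : ContDiff ℝ (⊤ : ℕ∞) f) (t : ℝ) :
    HasDerivAt (fun s => ∫ x in box, f (s, x)) (∫ x in box, dirDeriv timeDir f (t, x)) t := by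
  have hD := (hf.dirDeriv timeDir).continuous
  obtain ⟨C, hC⟩ := ((isCompact_Icc (a := t - 1) (b := t + 1)).prod
    isCompact_box).exists_bound_of_continuousOn hD.continuousOn
  refine (hasDerivAt_integral_of_dominated_loc_of_deriv_le (bound := fun _ => C)
    (Icc_mem_nhds (by linarith) (by linarith) : Icc (t - 1) (t + 1) ∈ 𝓝 t)
    (Eventually.of_forall fun s => (hf.continuous.integrableOn_box s).aestronglyMeasurable)
    (hf.continuous.integrableOn_box t) (hD.integrableOn_box t).aestronglyMeasurable
    ((ae_restrict_iff' measurableSet_Icc).2 (ae_of_all _ fun x hx s hs => hC (s, x) ⟨hs, hx⟩))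
    (continuousOn_const.integrableOn_compact isCompact_box)
    (ae_of_all _ fun x s _ => hasDerivAt_time_slice hf.differentiable_of_top s x)).2

/-- The weak maximum principle for periodic subsolutions of a drift-diffusion equation. -/
lemma SpacePeriodic.le_of_subsolution (hf : ContDiff ℝ (⊤ : ℕ∞) f) (hper : SpacePeriodic f)
    {ε T B : ℝ} {b : Fin 3 → ℝ × (Fin 3 → ℝ) → ℝ}
    (hsub : ∀ t ∈ Icc ε T, ∀ x, dirDeriv timeDir f (t, x)
      + ∑ j, b j (t, x) * dirDeriv (spaceDir j) f (t, x)
      - ∑ j, dirDeriv (spaceDir j) (dirDeriv (spaceDir j) f) (t, x) ≤ 0)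
    (hinit : ∀ x, f (ε, x) ≤ B) {t : ℝ} (ht : t ∈ Icc ε T) (x : Fin 3 → ℝ) : f (t, x) ≤ B := by
  have strict : ∀ δ > 0, f (t, x) - δ * (t - ε) ≤ B := by
    intro δ hδ
    set g : ℝ × (Fin 3 → ℝ) → ℝ := fun p => f p - δ * (p.1 - ε) with hgdef
    have hg : ContDiff ℝ (⊤ : ℕ∞) g := by fun_prop
    have hgper : SpacePeriodic g := by
      intro j p
      have := hper j p
      simp_all
    have hDg : ∀ v p, dirDeriv v g p = dirDeriv v f p - δ * v.1 := by
      intro v p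
      have h1 : HasFDerivAt (fun q : ℝ × (Fin 3 → ℝ) => δ * (q.1 - ε))
          (δ • ContinuousLinearMap.fst ℝ ℝ (Fin 3 → ℝ)) p :=
        (hasFDerivAt_fst.sub_const ε).const_mul δ
      rw [hgdef, dirDeriv_sub (hf.differentiable_of_top p) h1.differentiableAt]
      congr 1
      simp [dirDeriv, h1.fderiv]
    obtain ⟨⟨s, y⟩, ⟨hs, hy⟩, hmax⟩ := ((isCompact_Icc (a := ε) (b := T)).prod
      isCompact_box).exists_isMaxOn ⟨(t, 0), ht, ⟨le_rfl, fun _ => Real.two_pi_pos.le⟩⟩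
        hg.continuous.continuousOn
    have hglob : ∀ r ∈ Icc ε T, ∀ z, g (r, z) ≤ g (s, y) := by
      intro r hr z
      obtain ⟨w, hw, hwz⟩ := hgper.exists_mem_box r z
      rw [← hwz]
      exact hmax (show (r, w) ∈ Icc ε T ×ˢ box from ⟨hr, hw⟩)
    rcases (show ε ≤ s from hs.1).eq_or_lt with rfl | hlt
    · have h1 := hglob t ht x
      have h2 := hinit y
      simp only [hgdef, sub_self, mul_zero, sub_zero] at h1
      linarith
    · exfalso
      have hline : ∀ j, ∀ r : ℝ, g ((s, y) + r • spaceDir j) ≤ g (s, y) := by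
        intro j r
        simpa [spaceDir] using hglob s hs (y + r • Pi.single j 1)
      have hgrad : ∀ j, dirDeriv (spaceDir j) f (s, y) = 0 := by
        intro j
        have := dirDeriv_eq_zero_of_line_max hg.differentiable_of_top (hline j)
        simpa [hDg, spaceDir] using this
      have hlap : ∀ j, dirDeriv (spaceDir j) (dirDeriv (spaceDir j) f) (s, y) ≤ 0 := by
        intro j
        have h := dirDeriv_dirDeriv_nonpos_of_line_max hg (hline j)
        have hfun : dirDeriv (spaceDir j) g = dirDeriv (spaceDir j) f := by
          funext p
          simp [hDg, spaceDir]
        rwa [hfun] at h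
      have htime : 0 ≤ dirDeriv timeDir f (s, y) - δ := by
        have hloc : IsLocalMaxOn (fun r => g (r, y)) (Icc ε s) s :=
          IsMaxOn.localize fun r hr => hglob r ⟨hr.1, hr.2.trans hs.2⟩ y
        have hder := (hasDerivAt_time_slice hg.differentiable_of_top s y).hasFDerivAt
        have hle := hloc.hasFDerivWithinAt_nonpos hder.hasFDerivWithinAt
          (sub_mem_posTangentConeAt_of_segment_subset (y := ε) (by
            rw [segment_symm, segment_eq_Icc hs.1]))
        have h2 : dirDeriv timeDir g (s, y) = dirDeriv timeDir f (s, y) - δ := by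
          simp [hDg, timeDir]
        rw [← h2]
        have h3 : (ε - s) * dirDeriv timeDir g (s, y) ≤ 0 := by simpa using hle
        nlinarith
      have := hsub s hs y
      simp only [hgrad, mul_zero, Finset.sum_const_zero, add_zero] at this
      have h4 := Finset.sum_nonpos fun j (_ : j ∈ Finset.univ) => hlap j
      linarith
  refine le_of_forall_pos_le_add fun η hη => ?_
  have hpos : 0 < t - ε + 1 := by linarith [ht.1]
  have h := strict (η / (t - ε + 1)) (by positivity)
  have h2 : η / (t - ε + 1) * (t - ε) ≤ η := by
    rw [div_mul_eq_mul_div, div_le_iff₀ hpos]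
    nlinarith
  linarith

end Periodic

section Burgers

open Set

/-- `U` is a smooth spatially periodic solution of the diffusive Burgers equations on `[ε, T]`,
with derivatives taken in space-time. -/
structure IsBurgersSolution (ε T : ℝ) (U : Fin 3 → ℝ × (Fin 3 → ℝ) → ℝ) : Prop where
  contDiff : ∀ i, ContDiff ℝ (⊤ : ℕ∞) (U i)
  periodic : ∀ i, SpacePeriodic (U i)
  eqn : ∀ t ∈ Icc ε T, ∀ x i, dirDeriv timeDir (U i) (t, x)
      + ∑ j, U j (t, x) * dirDeriv (spaceDir j) (U i) (t, x)
      - ∑ j, dirDeriv (spaceDir j) (dirDeriv (spaceDir j) (U i)) (t, x) = 0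

variable {ε T B : ℝ} {U : Fin 3 → ℝ × (Fin 3 → ℝ) → ℝ}

lemma IsBurgersSolution.sum_sq_le (hU : IsBurgersSolution ε T U)
    (hinit : ∀ x, ∑ i, U i (ε, x) ^ 2 ≤ B) {t : ℝ} (ht : t ∈ Icc ε T) (x : Fin 3 → ℝ) :
    ∑ i, U i (t, x) ^ 2 ≤ B := by
  have hsm := hU.contDiff
  have hd : ∀ i, Differentiable ℝ (U i) := fun i => (hsm i).differentiable_of_top
  have hdd : ∀ i v, Differentiable ℝ (dirDeriv v (U i)) := fun i v =>
    ((hsm i).dirDeriv v).differentiable_of_top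
  have hD : ∀ v, dirDeriv v (fun p => ∑ i, U i p ^ 2)
      = fun p => ∑ i, 2 * (U i p * dirDeriv v (U i) p) := by
    intro v
    funext p
    rw [dirDeriv_sum _ fun i _ => (hd i p).fun_pow 2]
    exact Finset.sum_congr rfl fun i _ => by rw [dirDeriv_sq (hd i p)]; ring
  have hDD : ∀ v p, dirDeriv v (dirDeriv v (fun p => ∑ i, U i p ^ 2)) p
      = ∑ i, 2 * (dirDeriv v (U i) p ^ 2 + U i p * dirDeriv v (dirDeriv v (U i)) p) := by
    intro v p
    rw [hD, dirDeriv_sum _ fun i _ => ((hd i p).fun_mul (hdd i v p)).const_mul 2]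
    refine Finset.sum_congr rfl fun i _ => ?_
    rw [dirDeriv_mul (differentiableAt_const 2) ((hd i p).fun_mul (hdd i v p))]
    have := dirDeriv_mul (v := v) (hd i p) (hdd i v p)
    rw [this]
    simp [dirDeriv]
    ring
  refine SpacePeriodic.le_of_subsolution (f := fun p => ∑ i, U i p ^ 2) (b := U)
    (by fun_prop) (fun j p => ?_) (fun s hs y => ?_) hinit ht x
  · simp only [hU.periodic _ j p]
  · have hid : dirDeriv timeDir (fun p => ∑ i, U i p ^ 2) (s, y)
        + ∑ j, U j (s, y) * dirDeriv (spaceDir j) (fun p => ∑ i, U i p ^ 2) (s, y)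
        - ∑ j, dirDeriv (spaceDir j) (dirDeriv (spaceDir j) (fun p => ∑ i, U i p ^ 2)) (s, y)
        = -2 * ∑ i, ∑ j, dirDeriv (spaceDir j) (U i) (s, y) ^ 2 := by
      have e := hU.eqn s hs y
      simp only [hDD]
      simp only [hD]
      simp only [Fin.sum_univ_three] at e ⊢
      linear_combination 2 * U 0 (s, y) * e 0 + 2 * U 1 (s, y) * e 1 + 2 * U 2 (s, y) * e 2
    rw [hid]
    have : 0 ≤ ∑ i, ∑ j, dirDeriv (spaceDir j) (U i) (s, y) ^ 2 := by positivity
    linarith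

/-- The density of the squared `H¹` seminorm. -/
noncomputable def gradSq (U : Fin 3 → ℝ × (Fin 3 → ℝ) → ℝ) (p : ℝ × (Fin 3 → ℝ)) : ℝ :=
  ∑ i, ∑ j, dirDeriv (spaceDir j) (U i) p ^ 2

lemma contDiff_gradSq (hU : ∀ i, ContDiff ℝ (⊤ : ℕ∞) (U i)) :
    ContDiff ℝ (⊤ : ℕ∞) (gradSq U) :=
  ContDiff.sum fun i _ => ContDiff.sum fun _ _ => ((hU i).dirDeriv _).pow 2

/-- Integration by parts of the time derivative of the squared `H¹` seminorm. -/
lemma integral_dirDeriv_gradSq (hU : ∀ i, ContDiff ℝ (⊤ : ℕ∞) (U i))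
    (hper : ∀ i, SpacePeriodic (U i)) (t : ℝ) :
    ∫ x in box, dirDeriv timeDir (gradSq U) (t, x) = ∫ x in box, -2 * ∑ i,
      (∑ j, dirDeriv (spaceDir j) (dirDeriv (spaceDir j) (U i)) (t, x))
        * dirDeriv timeDir (U i) (t, x) := by
  have hdd : ∀ i v, Differentiable ℝ (dirDeriv v (U i)) := fun i v =>
    ((hU i).dirDeriv v).differentiable_of_top
  let F : Fin 3 → ℝ × (Fin 3 → ℝ) → ℝ := fun j p =>
    ∑ i, dirDeriv (spaceDir j) (U i) p * dirDeriv timeDir (U i) p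
  have hF : ∀ j, ContDiff ℝ (⊤ : ℕ∞) (F j) := fun j =>
    ContDiff.sum fun i _ => ((hU i).dirDeriv _).mul ((hU i).dirDeriv _)
  have hFper : ∀ j, SpacePeriodic (F j) := fun j k p => by
    simp only [F, ((hper _).dirDeriv _) k p]
  have hDF : ∀ j p, dirDeriv (spaceDir j) (F j) p
      = ∑ i, (dirDeriv (spaceDir j) (dirDeriv (spaceDir j) (U i)) p * dirDeriv timeDir (U i) p
        + dirDeriv (spaceDir j) (U i) p * dirDeriv timeDir (dirDeriv (spaceDir j) (U i)) p) := by
    intro j p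
    rw [dirDeriv_sum _ fun i _ => (hdd i _ p).fun_mul (hdd i _ p)]
    refine Finset.sum_congr rfl fun i _ => ?_
    rw [dirDeriv_comm (hU i) timeDir (spaceDir j)]
    exact dirDeriv_mul (hdd i _ p) (hdd i _ p)
  have hG : ∀ p, dirDeriv timeDir (gradSq U) p = ∑ i, ∑ j,
      2 * dirDeriv (spaceDir j) (U i) p * dirDeriv timeDir (dirDeriv (spaceDir j) (U i)) p := by
    intro p
    change dirDeriv timeDir (fun q => ∑ i, ∑ j, dirDeriv (spaceDir j) (U i) q ^ 2) p = _
    rw [dirDeriv_sum _ fun i _ => DifferentiableAt.fun_sum fun j _ => (hdd i _ p).fun_pow 2]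
    refine Finset.sum_congr rfl fun i _ => ?_
    rw [dirDeriv_sum _ fun j _ => (hdd i _ p).fun_pow 2]
    exact Finset.sum_congr rfl fun j _ => dirDeriv_sq (hdd i _ p)
  have hI1 := ((contDiff_gradSq hU).dirDeriv timeDir).continuous.integrableOn_box t
  have hI2 : IntegrableOn (fun x => ∑ j, dirDeriv (spaceDir j) (F j) (t, x)) box :=
    (continuous_finsetSum _ fun j _ => ((hF j).dirDeriv _).continuous).integrableOn_box t
  have hdiv := integral_box_divergence_eq_zero hF hFper t
  calc ∫ x in box, dirDeriv timeDir (gradSq U) (t, x)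
      = ∫ x in box, (dirDeriv timeDir (gradSq U) (t, x)
          - 2 * ∑ j, dirDeriv (spaceDir j) (F j) (t, x)) := by
        rw [integral_sub hI1 (hI2.const_mul 2), integral_const_mul, hdiv]
        simp
    _ = _ := by
        congr 1
        funext x
        simp only [hG, hDF, Fin.sum_univ_three]
        ring

lemma IsBurgersSolution.integral_dirDeriv_gradSq_le (hU : IsBurgersSolution ε T U)
    {t : ℝ} (ht : t ∈ Icc ε T) (hB : ∀ x, ∑ i, U i (t, x) ^ 2 ≤ B) :
    ∫ x in box, dirDeriv timeDir (gradSq U) (t, x) ≤ B * ∫ x in box, gradSq U (t, x) := by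
  have hsm := hU.contDiff
  rw [integral_dirDeriv_gradSq hsm hU.periodic, ← integral_const_mul]
  refine setIntegral_mono (Continuous.integrableOn_box (f := fun p => -2 * ∑ i,
      (∑ j, dirDeriv (spaceDir j) (dirDeriv (spaceDir j) (U i)) p) * dirDeriv timeDir (U i) p) ?_ t)
    (((contDiff_gradSq hsm).continuous.integrableOn_box t).const_mul B) fun x => ?_
  · exact continuous_const.mul (continuous_finsetSum _ fun i _ =>
      (continuous_finsetSum _ fun j _ => (((hsm i).dirDeriv _).dirDeriv _).continuous).mul
        ((hsm i).dirDeriv _).continuous)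
  · simp only [gradSq]
    rw [Finset.mul_sum, Finset.mul_sum]
    refine Finset.sum_le_sum fun i _ => ?_
    have hcs := Finset.sum_mul_sq_le_sq_mul_sq Finset.univ (fun j => U j (t, x))
      (fun j => dirDeriv (spaceDir j) (U i) (t, x))
    have heq := hU.eqn t ht x i
    have hnn : 0 ≤ ∑ j, dirDeriv (spaceDir j) (U i) (t, x) ^ 2 := by positivity
    have hle := mul_le_mul_of_nonneg_right (hB x) hnn
    set w := ∑ j, U j (t, x) * dirDeriv (spaceDir j) (U i) (t, x)
    set L := ∑ j, dirDeriv (spaceDir j) (dirDeriv (spaceDir j) (U i)) (t, x)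
    have hτ : dirDeriv timeDir (U i) (t, x) = L - w := by linarith
    rw [hτ]
    nlinarith [sq_nonneg (2 * L - w), sq_nonneg w]

/-- Grönwall's inequality for the squared `H¹` seminorm. -/
lemma IsBurgersSolution.integral_gradSq_le (hU : IsBurgersSolution ε T U)
    (hinit : ∀ x, ∑ i, U i (ε, x) ^ 2 ≤ B) {t : ℝ} (ht : t ∈ Icc ε T) :
    ∫ x in box, gradSq U (t, x) ≤ (∫ x in box, gradSq U (ε, x)) * Real.exp ((t - ε) * B) := by
  set e : ℝ → ℝ := fun s => ∫ x in box, gradSq U (s, x) with he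
  have hderiv : ∀ s, HasDerivAt (fun s => e s * Real.exp (-((s - ε) * B)))
      ((∫ x in box, dirDeriv timeDir (gradSq U) (s, x)) * Real.exp (-((s - ε) * B))
        + e s * (Real.exp (-((s - ε) * B)) * -(1 * B))) s := fun s =>
    (hasDerivAt_integral_box (contDiff_gradSq hU.contDiff) s).mul
      ((((hasDerivAt_id s).sub_const ε).mul_const B).neg.exp)
  have hanti : AntitoneOn (fun s => e s * Real.exp (-((s - ε) * B))) (Icc ε T) := by
    refine antitoneOn_of_deriv_nonpos (convex_Icc ε T)
      (fun s _ => (hderiv s).continuousAt.continuousWithinAt)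
      (fun s _ => (hderiv s).differentiableAt.differentiableWithinAt) fun s hs => ?_
    rw [(hderiv s).deriv]
    have hs' : s ∈ Icc ε T := interior_subset hs
    have h := hU.integral_dirDeriv_gradSq_le hs' fun x => hU.sum_sq_le hinit hs' x
    have hexp := Real.exp_pos (-((s - ε) * B))
    change (_ : ℝ) ≤ B * e s at h
    nlinarith
  have h := hanti (left_mem_Icc.2 (ht.1.trans ht.2)) ht ht.1
  simp only [sub_self, zero_mul, neg_zero, Real.exp_zero, mul_one, Real.exp_neg] at h
  rwa [← div_eq_mul_inv, div_le_iff₀ (Real.exp_pos _)] at h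

end Burgers

/-- Exponential `H¹`-seminorm bound for a smooth periodic solution of the diffusive Burgers
equations, combining the energy estimate with the maximum principle:
`‖∇u(t)‖_{L²} ≤ ‖∇u(ε)‖_{L²} exp((t-ε) ‖u(ε)‖_∞² / 2)`. -/
theorem burgers_H1_exponential_bound
    (ε T : ℝ) (u : ℝ → (Fin 3 → ℝ) → (Fin 3 → ℝ))
    (husm : ContDiff ℝ (⊤ : ℕ∞) (fun p : ℝ × (Fin 3 → ℝ) => u p.1 p.2))
    (huper : ∀ (t : ℝ) (x : Fin 3 → ℝ) (j : Fin 3), u t (x + Pi.single j (2 * Real.pi)) = u t x)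
    (hueq : ∀ t ∈ Set.Icc ε T, ∀ (x : Fin 3 → ℝ) (i : Fin 3),
      deriv (fun s => u s x i) t + ∑ j, u t x j * pd j (fun y => u t y i) x
        - lap (fun y => u t y i) x = 0) :
    ∀ t ∈ Set.Icc ε T,
      Real.sqrt (∫ x in box, ∑ i, ∑ j, (pd j (fun y => u t y i) x) ^ 2)
        ≤ Real.sqrt (∫ x in box, ∑ i, ∑ j, (pd j (fun y => u ε y i) x) ^ 2) *
            Real.exp ((t - ε) * (⨆ x : Fin 3 → ℝ, Real.sqrt (∑ i, (u ε x i) ^ 2)) ^ 2 / 2) := by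
  intro t ht
  set U : Fin 3 → ℝ × (Fin 3 → ℝ) → ℝ := fun i p => u p.1 p.2 i with hUdef
  have hsm : ∀ i, ContDiff ℝ (⊤ : ℕ∞) (U i) := fun i => contDiff_pi.1 husm i
  have hd : ∀ i, Differentiable ℝ (U i) := fun i => (hsm i).differentiable_of_top
  have hpd : ∀ (s : ℝ) (i j : Fin 3), pd j (fun y => u s y i)
      = fun x => dirDeriv (spaceDir j) (U i) (s, x) := fun s i j =>
    funext fun x => pd_slice (hd i) s x j
  have hlap : ∀ (s : ℝ) (x : Fin 3 → ℝ) (i : Fin 3), lap (fun y => u s y i) x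
      = ∑ j, dirDeriv (spaceDir j) (dirDeriv (spaceDir j) (U i)) (s, x) := by
    intro s x i
    simp only [lap, hpd]
    exact Finset.sum_congr rfl fun j _ =>
      pd_slice ((hsm i).dirDeriv _).differentiable_of_top s x j
  have hU : IsBurgersSolution ε T U := by
    refine ⟨hsm, fun i j p => ?_, fun s hs x i => ?_⟩
    · simp [hUdef, huper]
    · have h := hueq s hs x i
      rw [hlap, (hasDerivAt_time_slice (hd i) s x).deriv] at h
      simpa only [hpd] using h
  set M : ℝ := ⨆ x : Fin 3 → ℝ, Real.sqrt (∑ i, (u ε x i) ^ 2)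
  have hbdd : BddAbove (Set.range fun x : Fin 3 → ℝ => Real.sqrt (∑ i, (u ε x i) ^ 2)) := by
    set f : ℝ × (Fin 3 → ℝ) → ℝ := fun p => Real.sqrt (∑ i, (U i p) ^ 2) with hf
    have hfc : Continuous f := by
      have := fun i => (hsm i).continuous
      fun_prop
    have hfper : SpacePeriodic f := fun j p => by simp only [hf, hU.periodic _ j p]
    obtain ⟨C, hC⟩ := isCompact_box.bddAbove_image
      (f := fun x => f (ε, x)) (hfc.comp (by fun_prop)).continuousOn
    refine ⟨C, ?_⟩
    rintro _ ⟨x, rfl⟩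
    obtain ⟨y, hy, hyx⟩ := hfper.exists_mem_box ε x
    change f (ε, x) ≤ C
    rw [← hyx]
    exact hC (Set.mem_image_of_mem _ hy)
  have hinit : ∀ x, ∑ i, U i (ε, x) ^ 2 ≤ M ^ 2 := by
    intro x
    exact (Real.sqrt_le_left ((Real.sqrt_nonneg _).trans (le_ciSup hbdd 0))).1 (le_ciSup hbdd x)
  have hmain := hU.integral_gradSq_le hinit ht
  simp only [hpd]
  change Real.sqrt (∫ x in box, gradSq U (t, x)) ≤ Real.sqrt (∫ x in box, gradSq U (ε, x)) * _
  have hnn : 0 ≤ ∫ x in box, gradSq U (ε, x) := setIntegral_nonneg measurableSet_Icc fun x _ =>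
    Finset.sum_nonneg fun i _ => Finset.sum_nonneg fun j _ => sq_nonneg _
  rw [Real.exp_half, ← Real.sqrt_mul hnn]
  exact Real.sqrt_le_sqrt hmain
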